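/- Let κ be a perfect kernel on X, f an external field, and A ⊆ X with w_f(A) < ∞. Then there exists a unique measure ξ_{A,f} ∈ E⁺ (the extremal measure) such that every minimizing sequence (μ_j) ⊆ Ĕ⁺_f(A), i.e. one with I_f(μ_j) → w_f(A), converges to ξ_{A,f} both in the strong metric d and vaguely. -/

import Mathlib

open MeasureTheory Topology Filter Set ENNReal

noncomputable section

namespace GaussVar

variable {X : Type*} [TopologicalSpace X] [MeasurableSpace X]

/-- A (positive) Radon measure: a regular Borel measure. -/
def IsRadon (μ : Measure X) : Prop := μ.Regular

/-- The mutual energy `I(μ,ν) = ∬ κ(x,y) d(μ⊗ν)(x,y)`. -/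
def mutualEnergy (κ : X → X → ℝ≥0∞) (μ ν : Measure X) : ℝ≥0∞ :=
  ∫⁻ p : X × X, κ p.1 p.2 ∂(μ.prod ν)

/-- The energy `I(μ) := I(μ,μ)`. -/
def energy (κ : X → X → ℝ≥0∞) (μ : Measure X) : ℝ≥0∞ := mutualEnergy κ μ μ

/-- Membership in the cone `E⁺` of Radon measures with finite energy. -/
def memEplus (κ : X → X → ℝ≥0∞) (μ : Measure X) : Prop :=
  IsRadon μ ∧ energy κ μ < ⊤

/-- A kernel: symmetric and lower semicontinuous with values in `[0,∞]`. -/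
def IsKernel (κ : X → X → ℝ≥0∞) : Prop :=
  (∀ x y, κ x y = κ y x) ∧ LowerSemicontinuous (fun p : X × X => κ p.1 p.2)

/-- The strong (energy) metric `d(μ,ν) := (I(μ)+I(ν)−2I(μ,ν))^{1/2}` on `E⁺`. -/
def strongDist (κ : X → X → ℝ≥0∞) (μ ν : Measure X) : ℝ :=
  Real.sqrt ((energy κ μ).toReal + (energy κ ν).toReal - 2 * (mutualEnergy κ μ ν).toReal)

/-- The energy principle (strict positive definiteness). -/
def EnergyPrinciple (κ : X → X → ℝ≥0∞) : Prop :=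
  ∀ μ ν : Measure X, memEplus κ μ → memEplus κ ν →
    2 * mutualEnergy κ μ ν ≤ energy κ μ + energy κ ν ∧
      (2 * mutualEnergy κ μ ν = energy κ μ + energy κ ν → μ = ν)

/-- Convergence of a sequence in the strong metric. -/
def StrongTendstoSeq (κ : X → X → ℝ≥0∞) (μ : ℕ → Measure X) (μ₀ : Measure X) : Prop :=
  Tendsto (fun n => strongDist κ (μ n) μ₀) atTop (𝓝 0)

/-- Vague convergence of a sequence of measures. -/
def VagueTendstoSeq (μ : ℕ → Measure X) (μ₀ : Measure X) : Prop :=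
  ∀ φ : X → ℝ, Continuous φ → HasCompactSupport φ →
    Tendsto (fun n => ∫ x, φ x ∂(μ n)) atTop (𝓝 (∫ x, φ x ∂μ₀))

/-- Cauchy sequence in the strong metric. -/
def StrongCauchySeq (κ : X → X → ℝ≥0∞) (μ : ℕ → Measure X) : Prop :=
  ∀ ε : ℝ, 0 < ε → ∃ N : ℕ, ∀ m ≥ N, ∀ n ≥ N, strongDist κ (μ m) (μ n) < ε

/-- A perfect kernel: satisfies the energy principle, `(E⁺,d)` is complete, and
strong convergence implies vague convergence. -/
def IsPerfect (κ : X → X → ℝ≥0∞) : Prop :=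
  EnergyPrinciple κ ∧
    (∀ μ : ℕ → Measure X, (∀ n, memEplus κ (μ n)) → StrongCauchySeq κ μ →
        ∃ μ₀ : Measure X, memEplus κ μ₀ ∧ StrongTendstoSeq κ μ μ₀) ∧
    (∀ (μ : ℕ → Measure X) (μ₀ : Measure X), (∀ n, memEplus κ (μ n)) → memEplus κ μ₀ →
        StrongTendstoSeq κ μ μ₀ → VagueTendstoSeq μ μ₀)

/-- `μ` is concentrated on `A`: the complement of `A` is locally `μ`-negligible. -/
def Concentrated (μ : Measure X) (A : Set X) : Prop :=
  ∀ K : Set X, IsCompact K → μ (Aᶜ ∩ K) = 0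

/-- Membership in `Ĕ⁺(A)`: finite-energy Radon measures concentrated on `A`
of unit total mass. -/
def memBreve (κ : X → X → ℝ≥0∞) (A : Set X) (μ : Measure X) : Prop :=
  memEplus κ μ ∧ Concentrated μ A ∧ μ Set.univ = 1

/-- `w(A) := inf { I(μ) : μ ∈ Ĕ⁺(A) }` (with `inf ∅ = ⊤`). -/
def wcap (κ : X → X → ℝ≥0∞) (A : Set X) : ℝ≥0∞ :=
  ⨅ (μ : Measure X) (_ : memBreve κ A μ), energy κ μ

/-- The inner capacity `cap_*(A) := 1 / w(A)`. -/
def innerCap (κ : X → X → ℝ≥0∞) (A : Set X) : ℝ≥0∞ := (wcap κ A)⁻¹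

/-- The outer capacity `cap^*(E) := inf { cap_*(D) : D open, E ⊆ D }`. -/
def outerCap (κ : X → X → ℝ≥0∞) (E : Set X) : ℝ≥0∞ :=
  ⨅ (D : Set X) (_ : IsOpen D ∧ E ⊆ D), innerCap κ D

/-- `P` holds nearly everywhere (n.e.) on `A`: the exceptional subset of `A`
has inner capacity zero. -/
def NearlyEverywhere (κ : X → X → ℝ≥0∞) (A : Set X) (P : X → Prop) : Prop :=
  innerCap κ {x ∈ A | ¬ P x} = 0

/-- The potential `U^μ(x) := ∫ κ(x,y) dμ(y)`. -/
def potential (κ : X → X → ℝ≥0∞) (μ : Measure X) (x : X) : ℝ≥0∞ :=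
  ∫⁻ y, κ x y ∂μ

/-- An external field: `f = ψ + U^{ϑ⁺} − U^{ϑ⁻}` where `ψ` is lower semicontinuous,
`(−∞,∞]`-valued, positive if `X` is noncompact, and `ϑ⁺, ϑ⁻ ∈ E⁺`. -/
def IsExternalField (κ : X → X → ℝ≥0∞) (f : X → EReal) : Prop :=
  ∃ (ψ : X → EReal) (ϑp ϑm : Measure X),
    LowerSemicontinuous ψ ∧ (∀ x, ψ x ≠ ⊥) ∧ (¬ CompactSpace X → ∀ x, 0 ≤ ψ x) ∧
    memEplus κ ϑp ∧ memEplus κ ϑm ∧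
    ∀ x, f x = ψ x + (potential κ ϑp x : EReal) - (potential κ ϑm x : EReal)

/-- `f` is `μ`-integrable (as an extended-real-valued function). -/
def FieldIntegrable (f : X → EReal) (μ : Measure X) : Prop :=
  Integrable (fun x => (f x).toReal) μ ∧ (∀ᵐ x ∂μ, f x ≠ ⊤ ∧ f x ≠ ⊥)

/-- `∫ f dμ` for an a.e.-finite integrable field. -/
def fieldIntegral (f : X → EReal) (μ : Measure X) : ℝ := ∫ x, (f x).toReal ∂μ

/-- The Gauss functional `I_f(μ) := I(μ) + 2 ∫ f dμ`. -/
def gaussI (κ : X → X → ℝ≥0∞) (f : X → EReal) (μ : Measure X) : ℝ :=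
  (energy κ μ).toReal + 2 * fieldIntegral f μ

/-- Membership in `Ĕ⁺_f(A)`. -/
def Admissible (κ : X → X → ℝ≥0∞) (A : Set X) (f : X → EReal) (μ : Measure X) : Prop :=
  memBreve κ A μ ∧ FieldIntegrable f μ

/-- `w_f(A) := inf { I_f(μ) : μ ∈ Ĕ⁺_f(A) }` (with `inf ∅ = ⊤`). -/
def wf (κ : X → X → ℝ≥0∞) (A : Set X) (f : X → EReal) : EReal :=
  ⨅ (μ : Measure X) (_ : Admissible κ A f μ), ((gaussI κ f μ : ℝ) : EReal)

/-- `l` is a solution of the inner Gauss variational problem for `(A,f)`. -/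
def IsSolution (κ : X → X → ℝ≥0∞) (A : Set X) (f : X → EReal) (l : Measure X) : Prop :=
  Admissible κ A f l ∧ ((gaussI κ f l : ℝ) : EReal) = wf κ A f

/-- The `f`-weighted potential `U_f^μ := U^μ + f`. -/
def wPotential (κ : X → X → ℝ≥0∞) (f : X → EReal) (μ : Measure X) (x : X) : EReal :=
  (potential κ μ x : EReal) + f x

/-- `∫ U_f^μ dμ`, the weighted equilibrium constant of a solution. -/
def wConst (κ : X → X → ℝ≥0∞) (f : X → EReal) (μ : Measure X) : ℝ :=
  ∫ x, (wPotential κ f μ x).toReal ∂μ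

/-- The cone `E⁺(A)` is closed in the strong metric. -/
def StrongClosedEplusOn (κ : X → X → ℝ≥0∞) (A : Set X) : Prop :=
  ∀ (μ : ℕ → Measure X) (μ₀ : Measure X),
    (∀ n, memEplus κ (μ n) ∧ Concentrated (μ n) A) →
    memEplus κ μ₀ → StrongTendstoSeq κ μ μ₀ → Concentrated μ₀ A

/-- Frostman's (first) maximum principle. -/
def FrostmanMax (κ : X → X → ℝ≥0∞) : Prop :=
  ∀ μ : Measure X, memEplus κ μ →
    (∀ x : X, (∀ U : Set X, IsOpen U → x ∈ U → 0 < μ U) → potential κ μ x ≤ 1) →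
    ∀ x : X, potential κ μ x ≤ 1

/-- The domination (second maximum) principle. -/
def DominationPrinciple (κ : X → X → ℝ≥0∞) : Prop :=
  ∀ μ ν : Measure X, memEplus κ μ → memEplus κ ν →
    (∀ᵐ x ∂μ, potential κ μ x ≤ potential κ ν x) →
    ∀ x : X, potential κ μ x ≤ potential κ ν x

/-- `β` is the inner balayage of `ζ` onto `A`: `β ∈ E⁺(A)` and `U^β = U^ζ` n.e. on `A`. -/
def IsInnerBalayage (κ : X → X → ℝ≥0∞) (A : Set X) (ζ β : Measure X) : Prop :=
  memEplus κ β ∧ Concentrated β A ∧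
    NearlyEverywhere κ A (fun x => potential κ β x = potential κ ζ x)

/-- `γ` is the inner capacitary measure of `A`: `γ ∈ E⁺(A)` and `U^γ = 1` n.e. on `A`. -/
def IsCapacitaryMeasure (κ : X → X → ℝ≥0∞) (A : Set X) (γ : Measure X) : Prop :=
  memEplus κ γ ∧ Concentrated γ A ∧
    NearlyEverywhere κ A (fun x => potential κ γ x = 1)

/-- `A` is quasiclosed: approximable in outer capacity by closed sets. -/
def Quasiclosed (κ : X → X → ℝ≥0∞) (A : Set X) : Prop :=
  ∀ ε : ℝ≥0∞, 0 < ε → ∃ F : Set X, IsClosed F ∧ outerCap κ (symmDiff A F) < ε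

/-- `A` is quasicompact: approximable in outer capacity by compact sets. -/
def Quasicompact (κ : X → X → ℝ≥0∞) (A : Set X) : Prop :=
  ∀ ε : ℝ≥0∞, 0 < ε → ∃ K : Set X, IsCompact K ∧ outerCap κ (symmDiff A K) < ε


open scoped NNReal

/-- Chebyshev-type bound against a simple function, using compact subsets of its level sets. -/
lemma sum_mul_measure_compact_le_lintegral {μ : Measure X} [T2Space X] [OpensMeasurableSpace X]
    (s : SimpleFunc X ℝ≥0) (r : ℝ≥0) (K : ℝ≥0 → Set X) (hK : ∀ c, IsCompact (K c))
    (hKs : ∀ c, K c ⊆ s ⁻¹' {c}) (f : X → ℝ≥0∞) (hf : ∀ c, ∀ x ∈ K c, (r * c : ℝ≥0∞) ≤ f x) :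
    ∑ c ∈ s.range, r * c * μ (K c) ≤ ∫⁻ x, f x ∂μ := by
  calc ∑ c ∈ s.range, r * c * μ (K c)
      = ∑ c ∈ s.range, ∫⁻ x, (K c).indicator (fun _ => (r * c : ℝ≥0∞)) x ∂μ := by
        refine Finset.sum_congr rfl fun c _ => ?_
        rw [lintegral_indicator_const (hK c).measurableSet]
    _ = ∫⁻ x, ∑ c ∈ s.range, (K c).indicator (fun _ => (r * c : ℝ≥0∞)) x ∂μ := by
        rw [lintegral_finsetSum]
        exact fun c _ => measurable_const.indicator (hK c).measurableSet
    _ ≤ ∫⁻ x, f x ∂μ := by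
        refine lintegral_mono fun x => ?_
        rw [Finset.sum_eq_single (s x)]
        · by_cases hx : x ∈ K (s x)
          · simpa [hx] using hf _ x hx
          · simp [hx]
        · intro c _ hc
          refine Set.indicator_of_notMem (fun hx => hc ?_) _
          exact (hKs c hx).symm
        · intro h
          exact absurd (s.mem_range_self x) h

/-- `τ`-additivity of regular measures on directed families of lower semicontinuous functions. -/
lemma lintegral_iSup_le_of_directed_lowerSemicontinuous [T2Space X] [BorelSpace X]
    {μ : Measure X} [μ.Regular] {ι : Type*} [Nonempty ι] (f : ι → X → ℝ≥0∞)
    (hlsc : ∀ i, LowerSemicontinuous (f i)) (hdir : Directed (· ≤ ·) f) :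
    ∫⁻ x, ⨆ i, f i x ∂μ ≤ ⨆ i, ∫⁻ x, f i x ∂μ := by
  classical
  have key : ∀ (K : Set X) (a : ℝ≥0∞), IsCompact K → (∀ x ∈ K, a < ⨆ i, f i x) →
      ∃ i, ∀ x ∈ K, a < f i x := by
    intro K a hK h
    obtain ⟨i, hi⟩ := hK.elim_directed_cover (fun i => f i ⁻¹' Ioi a)
      (fun i => (hlsc i).isOpen_preimage a)
      (fun x hx => by simpa [lt_iSup_iff] using h x hx)
      (fun i j => by
        obtain ⟨k, hik, hjk⟩ := hdir i j
        exact ⟨k, fun x hx => lt_of_lt_of_le hx (hik x), fun x hx => lt_of_lt_of_le hx (hjk x)⟩)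
    exact ⟨i, fun x hx => hi hx⟩
  have hopen : ∀ a : ℝ≥0∞, IsOpen {x | a < ⨆ i, f i x} := fun a =>
    (lowerSemicontinuous_iSup hlsc).isOpen_preimage a
  rw [lintegral_eq_nnreal]
  refine iSup₂_le fun s hs => ?_
  by_cases hfin : ∀ c ∈ s.range, c ≠ 0 → μ (s ⁻¹' {c}) ≠ ∞
  · refine ENNReal.le_of_forall_lt_one_mul_le fun a ha => ?_
    lift a to ℝ≥0 using ha.ne_top with r
    replace ha : r < 1 := by exact_mod_cast ha
    refine ENNReal.le_of_forall_pos_le_add fun δ hδ _ => ?_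
    set C : ℝ≥0 := ∑ c ∈ s.range, r * c with hC
    set ε : ℝ≥0 := δ / (C + 1) with hε
    have hε0 : 0 < ε := by positivity
    have hCε : C * ε ≤ δ := by
      rw [hε, mul_div_assoc', div_le_iff₀ (by positivity), mul_comm]
      gcongr
      exact le_self_add
    have hex : ∀ c : ℝ≥0, ∃ K : Set X, IsCompact K ∧ K ⊆ s ⁻¹' {c} ∧ (c = 0 → K = ∅) ∧
        (c ∈ s.range → (r * (c * μ (s ⁻¹' {c})) : ℝ≥0∞) ≤ r * c * μ K + r * c * ε) := by
      intro c
      by_cases hc : c ∈ s.range ∧ c ≠ 0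
      · obtain ⟨K, hKs, hK, hlt⟩ := (s.measurableSet_fiber c).exists_isCompact_lt_add
          (hfin c hc.1 hc.2) (ε := ε) (by exact_mod_cast hε0.ne')
        refine ⟨K, hK, hKs, fun h => absurd h hc.2, fun _ => ?_⟩
        rw [← mul_assoc, ← mul_add]
        gcongr
      · refine ⟨∅, isCompact_empty, empty_subset _, fun _ => rfl, fun h => ?_⟩
        have : c = 0 := by tauto
        simp [this]
    choose K hK hKs hK0 hKμ using hex
    have hlt : ∀ c, c ≠ 0 → ∃ i, ∀ x ∈ K c, ((r * c : ℝ≥0) : ℝ≥0∞) < f i x := by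
      intro c hc
      refine key _ _ (hK c) fun x hx => lt_of_lt_of_le ?_ (hs x)
      have : s x = c := hKs c hx
      rw [this]
      exact_mod_cast mul_lt_of_lt_one_left (pos_iff_ne_zero.2 hc) ha
    choose! j hj using hlt
    obtain ⟨i, hi⟩ := hdir.finset_le (s.range.image j)
    have hle := sum_mul_measure_compact_le_lintegral (μ := μ) s r
      (fun c => if c ∈ s.range then K c else ∅)
      (fun c => by split_ifs; exacts [hK c, isCompact_empty])
      (fun c => by split_ifs; exacts [hKs c, empty_subset _]) (f i) (by
        intro c x hx
        split_ifs at hx with hc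
        · by_cases hc0 : c = 0
          · simp [hK0 c hc0] at hx
          · refine le_trans ?_ (hi (j c) (Finset.mem_image_of_mem _ hc) x)
            exact_mod_cast (hj c hc0 x hx).le
        · simp at hx)
    rw [SimpleFunc.map_lintegral, Finset.mul_sum]
    calc ∑ c ∈ s.range, (r * (c * μ (s ⁻¹' {c})) : ℝ≥0∞)
        ≤ ∑ c ∈ s.range, (r * c * μ (K c) + r * c * ε : ℝ≥0∞) :=
          Finset.sum_le_sum fun c hc => hKμ c hc
      _ = ∑ c ∈ s.range, (r * c * μ (if c ∈ s.range then K c else ∅) : ℝ≥0∞)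
          + ((C * ε : ℝ≥0) : ℝ≥0∞) := by
          rw [Finset.sum_add_distrib, hC, Finset.sum_mul]
          push_cast
          congr 1
          exact Finset.sum_congr rfl fun c hc => by rw [if_pos hc]
      _ ≤ (⨆ i, ∫⁻ x, f i x ∂μ) + δ := by
          gcongr
          exact hle.trans (le_iSup (fun i => ∫⁻ x, f i x ∂μ) i)
  · push Not at hfin
    obtain ⟨c, -, hc0, hc⟩ := hfin
    have hU : μ {x | ((c / 2 : ℝ≥0) : ℝ≥0∞) < ⨆ i, f i x} = ∞ := by
      refine measure_mono_top (fun x hx => ?_) hc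
      refine lt_of_lt_of_le ?_ (hs x)
      have : s x = c := hx
      rw [this]
      exact_mod_cast NNReal.half_lt_self hc0
    have : (⨆ i, ∫⁻ x, f i x ∂μ) = ∞ := by
      refine ENNReal.eq_top_of_forall_nnreal_le fun M => ?_
      obtain ⟨K, hKU, hK, hMK⟩ := (hopen ((c / 2 : ℝ≥0) : ℝ≥0∞)).exists_lt_isCompact (μ := μ)
        (r := M / (c / 2 : ℝ≥0)) (by
          rw [hU]
          exact ENNReal.div_lt_top ENNReal.coe_ne_top (by simpa using hc0))
      obtain ⟨i, hi⟩ := key K _ hK (fun x hx => hKU hx)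
      refine le_trans ?_ (le_iSup _ i)
      calc (M : ℝ≥0∞) = (c / 2 : ℝ≥0) * (M / (c / 2 : ℝ≥0)) := by
            rw [ENNReal.mul_div_cancel (by simpa using hc0) ENNReal.coe_ne_top]
        _ ≤ (c / 2 : ℝ≥0) * μ K := by gcongr
        _ = ∫⁻ x in K, (c / 2 : ℝ≥0) ∂μ := by simp
        _ ≤ ∫⁻ x in K, f i x ∂μ := setLIntegral_mono' hK.measurableSet fun x hx => (hi x hx).le
        _ ≤ ∫⁻ x, f i x ∂μ := setLIntegral_le_lintegral _ _
    rw [this]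
    exact le_top


/-- Elementary minorants of a kernel: finite suprema of constants on open rectangles whose second
side has finite `θ`-measure. -/
def RectMinorant (κ : X → X → ℝ≥0∞) (θ : Measure X) : Type _ :=
  {T : Finset (ℝ≥0∞ × Set X × Set X) // ∀ p ∈ T, IsOpen p.2.1 ∧ IsOpen p.2.2 ∧ θ p.2.2 < ∞ ∧
    ∀ x ∈ p.2.1, ∀ y ∈ p.2.2, p.1 ≤ κ x y}

namespace RectMinorant

variable {κ : X → X → ℝ≥0∞} {θ : Measure X}

/-- The function on `X × X` attached to an elementary minorant. -/
def toFun (T : RectMinorant κ θ) (x y : X) : ℝ≥0∞ :=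
  T.1.sup fun p => (p.2.1 ×ˢ p.2.2).indicator (fun _ => p.1) (x, y)

/-- The union of the second sides of the rectangles. -/
def side (T : RectMinorant κ θ) : Set X := ⋃ p ∈ T.1, p.2.2

instance : Nonempty (RectMinorant κ θ) := ⟨⟨∅, by simp⟩⟩

lemma directed_toFun : Directed (· ≤ ·) (toFun : RectMinorant κ θ → X → X → ℝ≥0∞) := by
  classical
  intro S T
  refine ⟨⟨S.1 ∪ T.1, fun p hp => ?_⟩, fun x y => Finset.sup_mono Finset.subset_union_left,
    fun x y => Finset.sup_mono Finset.subset_union_right⟩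
  rcases Finset.mem_union.1 hp with h | h
  exacts [S.2 p h, T.2 p h]

lemma toFun_le (T : RectMinorant κ θ) (x y : X) : T.toFun x y ≤ κ x y := by
  refine Finset.sup_le fun p hp => ?_
  by_cases h : (x, y) ∈ p.2.1 ×ˢ p.2.2
  · rw [Set.indicator_of_mem h]
    exact (T.2 p hp).2.2.2 x h.1 y h.2
  · simp [Set.indicator_of_notMem h]

lemma eventually_toFun_le (T : RectMinorant κ θ) (x : X) :
    ∀ᶠ z in 𝓝 x, ∀ y, T.toFun x y ≤ T.toFun z y := by
  have : ∀ᶠ z in 𝓝 x, ∀ p ∈ T.1, x ∈ p.2.1 → z ∈ p.2.1 := by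
    rw [Filter.eventually_all_finset]
    intro p hp
    by_cases hx : x ∈ p.2.1
    · filter_upwards [(T.2 p hp).1.mem_nhds hx] with z hz _ using hz
    · exact Eventually.of_forall fun z h => absurd h hx
  filter_upwards [this] with z hz y
  refine Finset.sup_mono_fun fun p hp => ?_
  by_cases h : (x, y) ∈ p.2.1 ×ˢ p.2.2
  · have h' : (z, y) ∈ p.2.1 ×ˢ p.2.2 := ⟨hz p hp h.1, h.2⟩
    rw [Set.indicator_of_mem h, Set.indicator_of_mem h']
  · simp [Set.indicator_of_notMem h]

lemma measurable_toFun [OpensMeasurableSpace X] (T : RectMinorant κ θ) :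
    Measurable fun p : X × X => T.toFun p.1 p.2 := by
  have : (fun p : X × X => T.toFun p.1 p.2) =
      T.1.sup fun p => (p.2.1 ×ˢ p.2.2).indicator (fun _ => p.1) := by
    ext q
    simp [toFun, Finset.sup_apply]
  rw [this]
  refine Finset.sup_induction measurable_const (fun _ h₁ _ h₂ => h₁.sup h₂)
    fun p hp => measurable_const.indicator ?_
  exact (T.2 p hp).1.measurableSet.prod (T.2 p hp).2.1.measurableSet

lemma lowerSemicontinuous_toFun_right (T : RectMinorant κ θ) (x : X) :
    LowerSemicontinuous (T.toFun x) := by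
  intro y b hb
  obtain ⟨p, hp, hlt⟩ := Finset.lt_sup_iff.1 hb
  have hmem : (x, y) ∈ p.2.1 ×ˢ p.2.2 := by
    by_contra h
    simp [Set.indicator_of_notMem h] at hlt
  filter_upwards [(T.2 p hp).2.1.mem_nhds hmem.2] with z hz
  refine Finset.lt_sup_iff.2 ⟨p, hp, ?_⟩
  have h' : (x, z) ∈ p.2.1 ×ˢ p.2.2 := ⟨hmem.1, hz⟩
  rwa [Set.indicator_of_mem h', ← Set.indicator_of_mem hmem (fun _ => p.1)]

lemma measure_side_lt_top (T : RectMinorant κ θ) : θ T.side < ∞ :=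
  measure_biUnion_lt_top T.1.finite_toSet fun p hp => (T.2 p hp).2.2.1

lemma toFun_eq_zero (T : RectMinorant κ θ) {x y : X} (hy : y ∉ T.side) : T.toFun x y = 0 := by
  refine le_antisymm (Finset.sup_le fun p hp => ?_) bot_le
  rw [Set.indicator_of_notMem]
  exact fun h => hy (mem_biUnion hp h.2)

lemma iSup_toFun [IsLocallyFiniteMeasure θ]
    (hκ : LowerSemicontinuous fun p : X × X => κ p.1 p.2) (x y : X) :
    ⨆ T : RectMinorant κ θ, T.toFun x y = κ x y := by
  refine le_antisymm (iSup_le fun T => T.toFun_le x y) (le_of_forall_lt fun c hc => ?_)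
  obtain ⟨b, hcb, hb⟩ := exists_between hc
  obtain ⟨U, V, hU, hxU, hV, hyV, hUV⟩ := mem_nhds_prod_iff'.1 (hκ (x, y) b hb)
  obtain ⟨W, hyW, hW, hWθ⟩ := θ.exists_isOpen_measure_lt_top y
  refine hcb.trans_le (le_iSup_of_le ⟨{(b, U, V ∩ W)}, ?_⟩ ?_)
  · intro p hp
    obtain rfl := Finset.mem_singleton.1 hp
    refine ⟨hU, hV.inter hW, (measure_mono inter_subset_right).trans_lt hWθ, fun x hx y hy => ?_⟩
    exact (hUV (mk_mem_prod hx hy.1) : b < κ x y).le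
  · simp [toFun, hxU, hyV, hyW]

end RectMinorant

/-- One half of Fubini's theorem for lower semicontinuous kernels, with the second measure
restricted to sets of finite measure. -/
lemma lintegral_potential_le_of_forall_restrict [T2Space X] [LocallyCompactSpace X] [BorelSpace X]
    {κ : X → X → ℝ≥0∞} (hκ : LowerSemicontinuous fun p : X × X => κ p.1 p.2)
    {μ θ : Measure X} [μ.Regular] [θ.Regular] {B : ℝ≥0∞}
    (hB : ∀ W : Set X, θ W < ∞ → mutualEnergy κ μ (θ.restrict W) ≤ B) :
    ∫⁻ x, potential κ θ x ∂μ ≤ B := by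
  let Φ : RectMinorant κ θ → X → ℝ≥0∞ := fun T x => ∫⁻ y, T.toFun x y ∂θ
  have hpot : ∀ x, potential κ θ x ≤ ⨆ T, Φ T x := by
    intro x
    have h : potential κ θ x = ∫⁻ y, ⨆ T : RectMinorant κ θ, T.toFun x y ∂θ :=
      lintegral_congr fun y => (RectMinorant.iSup_toFun hκ x y).symm
    rw [h]
    refine lintegral_iSup_le_of_directed_lowerSemicontinuous
      (fun (T : RectMinorant κ θ) y => T.toFun x y)
      (fun T => T.lowerSemicontinuous_toFun_right x) fun S T => ?_
    obtain ⟨R, hS, hT⟩ := RectMinorant.directed_toFun S T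
    exact ⟨R, hS x, hT x⟩
  refine (lintegral_mono hpot).trans ((lintegral_iSup_le_of_directed_lowerSemicontinuous Φ
    (fun T x b hb => ?_) fun S T => ?_).trans (iSup_le fun T => ?_))
  · filter_upwards [T.eventually_toFun_le x] with z hz
    exact lt_of_lt_of_le hb (lintegral_mono hz)
  · obtain ⟨R, hS, hT⟩ := RectMinorant.directed_toFun S T
    exact ⟨R, fun x => lintegral_mono (hS x), fun x => lintegral_mono (hT x)⟩
  · have : Fact (θ T.side < ∞) := ⟨T.measure_side_lt_top⟩
    refine le_trans ?_ (hB T.side T.measure_side_lt_top)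
    calc ∫⁻ x, Φ T x ∂μ = ∫⁻ x, ∫⁻ y, T.toFun x y ∂(θ.restrict T.side) ∂μ := by
          refine lintegral_congr fun x => (setLIntegral_eq_of_support_subset ?_).symm
          exact fun y hy => by_contra fun h => hy (T.toFun_eq_zero h)
      _ = ∫⁻ p, T.toFun p.1 p.2 ∂(μ.prod (θ.restrict T.side)) :=
          (lintegral_prod _ T.measurable_toFun.aemeasurable).symm
      _ ≤ mutualEnergy κ μ (θ.restrict T.side) := lintegral_mono fun p => T.toFun_le p.1 p.2

lemma restrict_prod_restrict_le {Y : Type*} [MeasurableSpace Y] {θ : Measure Y} {W : Set Y}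
    (hW : θ W < ∞) (h : θ.prod θ ≠ 0) : (θ.restrict W).prod (θ.restrict W) ≤ θ.prod θ := by
  have : Fact (θ W < ∞) := ⟨hW⟩
  have hmeas : AEMeasurable (fun x => θ.map (Prod.mk x)) θ := by
    by_contra hn
    refine h ?_
    rw [Measure.prod, Measure.bind, Measure.map_of_not_aemeasurable hn, Measure.join_zero]
  refine Measure.le_iff.2 fun S hS => ?_
  rw [Measure.prod_apply hS, Measure.prod, Measure.bind_apply hS hmeas]
  calc ∫⁻ x in W, θ.restrict W (Prod.mk x ⁻¹' S) ∂θ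
      ≤ ∫⁻ x, θ.restrict W (Prod.mk x ⁻¹' S) ∂θ := setLIntegral_le_lintegral _ _
    _ ≤ ∫⁻ x, θ.map (Prod.mk x) S ∂θ := by
        refine lintegral_mono fun x => ?_
        rw [Measure.map_apply measurable_prodMk_left hS]
        exact Measure.restrict_apply_le _ _

lemma memEplus_zero [T2Space X] [BorelSpace X] (κ : X → X → ℝ≥0∞) :
    memEplus κ (0 : Measure X) := by
  refine ⟨Measure.Regular.zero, ?_⟩
  simp [energy, mutualEnergy]

lemma EnergyPrinciple.two_mul_lintegral_potential_le [T2Space X] [LocallyCompactSpace X]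
    [BorelSpace X] {κ : X → X → ℝ≥0∞} (hE : EnergyPrinciple κ)
    (hκ : LowerSemicontinuous fun p : X × X => κ p.1 p.2) {μ θ : Measure X}
    (hμ : memEplus κ μ) (hθ : memEplus κ θ) :
    2 * ∫⁻ x, potential κ θ x ∂μ ≤ energy κ μ + energy κ θ := by
  have : μ.Regular := hμ.1
  have : θ.Regular := hθ.1
  by_cases h : θ.prod θ = 0
  · have : θ = 0 := by
      refine (hE θ 0 hθ (memEplus_zero κ)).2 ?_
      simp [energy, mutualEnergy, h]
    simp [this, potential]
  have hB : ∫⁻ x, potential κ θ x ∂μ ≤ (energy κ μ + energy κ θ) / 2 := by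
    refine lintegral_potential_le_of_forall_restrict hκ fun W hW => ?_
    have hle : energy κ (θ.restrict W) ≤ energy κ θ :=
      lintegral_mono' (restrict_prod_restrict_le hW h) le_rfl
    have hW' : memEplus κ (θ.restrict W) :=
      ⟨Measure.Regular.restrict_of_measure_ne_top hW.ne, hle.trans_lt hθ.2⟩
    rw [ENNReal.le_div_iff_mul_le (by simp) (by simp), mul_comm]
    exact (hE μ _ hμ hW').1.trans (by gcongr)
  calc 2 * ∫⁻ x, potential κ θ x ∂μ ≤ 2 * ((energy κ μ + energy κ θ) / 2) := by gcongr
    _ = _ := ENNReal.mul_div_cancel (by simp) (by simp)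

/-- The lower semicontinuous part of an external field is bounded below. -/
lemma exists_forall_neg_le_of_lowerSemicontinuous {Y : Type*} [TopologicalSpace Y]
    {ψ : Y → EReal} (hψ : LowerSemicontinuous ψ)
    (hbot : ∀ x, ψ x ≠ ⊥) (hnc : ¬ CompactSpace Y → ∀ x, 0 ≤ ψ x) :
    ∃ c : ℝ, 0 ≤ c ∧ ∀ x, ((-c : ℝ) : EReal) ≤ ψ x := by
  by_cases hX : CompactSpace Y
  · rcases isEmpty_or_nonempty Y with hX' | hX'
    · exact ⟨0, le_rfl, fun x => (hX'.false x).elim⟩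
    obtain ⟨a, -, ha⟩ := LowerSemicontinuousOn.exists_isMinOn (Set.univ_nonempty (α := Y))
      isCompact_univ (hψ.lowerSemicontinuousOn _)
    obtain ⟨r, -, hr⟩ := EReal.lt_iff_exists_real_btwn.1 (bot_lt_iff_ne_bot.2 (hbot a))
    refine ⟨max 0 (-r), le_max_left _ _, fun x => ?_⟩
    refine le_trans ?_ (hr.le.trans (ha (mem_univ x)))
    exact_mod_cast by linarith [le_max_right 0 (-r)]
  · exact ⟨0, le_rfl, by simpa using hnc hX⟩

lemma IsExternalField.exists_le_gaussI [T2Space X] [LocallyCompactSpace X] [BorelSpace X]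
    {κ : X → X → ℝ≥0∞} {f : X → EReal} (hf : IsExternalField κ f) (hE : EnergyPrinciple κ)
    (hκ : LowerSemicontinuous fun p : X × X => κ p.1 p.2) (A : Set X) :
    ∃ m : ℝ, ∀ μ : Measure X, Admissible κ A f μ → m ≤ gaussI κ f μ := by
  obtain ⟨ψ, ϑp, ϑm, hψ, hbot, hnc, -, hm, hfx⟩ := hf
  obtain ⟨c, hc0, hc⟩ := exists_forall_neg_le_of_lowerSemicontinuous hψ hbot hnc
  refine ⟨-(2 * c) - (energy κ ϑm).toReal, fun μ hμ => ?_⟩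
  obtain ⟨⟨hμE, -, hμ1⟩, hint, hfin⟩ := hμ
  have hpot := hE.two_mul_lintegral_potential_le hκ hμE hm
  have hneg : ∫⁻ x, ENNReal.ofReal (-(f x).toReal) ∂μ
      ≤ ENNReal.ofReal c + ∫⁻ x, potential κ ϑm x ∂μ := by
    have hcint : ∫⁻ _, ENNReal.ofReal c ∂μ = ENNReal.ofReal c := by simp [hμ1]
    calc ∫⁻ x, ENNReal.ofReal (-(f x).toReal) ∂μ
        ≤ ∫⁻ x, (ENNReal.ofReal c + potential κ ϑm x) ∂μ := by
          refine lintegral_mono_ae ?_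
          filter_upwards [hfin] with x hx
          by_cases hu : potential κ ϑm x = ⊤
          · simp [hu]
          have hlow : ((-c : ℝ) : EReal) - ((potential κ ϑm x).toReal : ℝ) ≤ f x := by
            rw [hfx x, ← EReal.coe_ennreal_toReal hu]
            refine EReal.sub_le_sub ?_ le_rfl
            calc ((-c : ℝ) : EReal) = ((-c : ℝ) : EReal) + 0 := (add_zero _).symm
              _ ≤ _ := add_le_add (hc x) (EReal.coe_ennreal_nonneg _)
          rw [← EReal.coe_toReal hx.1 hx.2] at hlow
          have hlow' : -c - (potential κ ϑm x).toReal ≤ (f x).toReal := by exact_mod_cast hlow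
          rw [← ENNReal.ofReal_toReal hu, ← ENNReal.ofReal_add hc0 ENNReal.toReal_nonneg]
          exact ENNReal.ofReal_le_ofReal (by linarith)
      _ = _ := by rw [lintegral_add_left measurable_const, hcint]
  have hEfin : energy κ μ + energy κ ϑm ≠ ⊤ := (ENNReal.add_lt_top.2 ⟨hμE.2, hm.2⟩).ne
  have hpfin : ∫⁻ x, potential κ ϑm x ∂μ ≠ ⊤ := by
    intro h
    rw [h] at hpot
    exact hEfin (top_le_iff.1 (by simpa using hpot))
  have hpot' : 2 * (∫⁻ x, potential κ ϑm x ∂μ).toReal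
      ≤ (energy κ μ).toReal + (energy κ ϑm).toReal := by
    rw [← ENNReal.toReal_add hμE.2.ne hm.2.ne]
    simpa using ENNReal.toReal_mono hEfin hpot
  have hneg' : (∫⁻ x, ENNReal.ofReal (-(f x).toReal) ∂μ).toReal
      ≤ c + (∫⁻ x, potential κ ϑm x ∂μ).toReal := by
    have := ENNReal.toReal_mono (ENNReal.add_ne_top.2 ⟨ENNReal.ofReal_ne_top, hpfin⟩) hneg
    rwa [ENNReal.toReal_add ENNReal.ofReal_ne_top hpfin, ENNReal.toReal_ofReal hc0] at this
  have hfi : -(∫⁻ x, ENNReal.ofReal (-(f x).toReal) ∂μ).toReal ≤ fieldIntegral f μ := by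
    rw [fieldIntegral, integral_eq_lintegral_pos_part_sub_lintegral_neg_part hint]
    linarith [ENNReal.toReal_nonneg (a := ∫⁻ x, ENNReal.ofReal ((f x).toReal) ∂μ)]
  rw [gaussI]
  linarith

lemma mutualEnergy_comm {Y : Type*} [MeasurableSpace Y] {κ : Y → Y → ℝ≥0∞}
    (hκ : ∀ x y, κ x y = κ y x) (μ ν : Measure Y) [SFinite μ] [SFinite ν] :
    mutualEnergy κ μ ν = mutualEnergy κ ν μ := by
  rw [mutualEnergy, mutualEnergy, ← Measure.prod_swap (μ := μ) (ν := ν),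
    show (Prod.swap : Y × Y → Y × Y) = MeasurableEquiv.prodComm from rfl, lintegral_map_equiv]
  exact lintegral_congr fun p => hκ _ _

/-- The midpoint of two measures. -/
def midMeasure (μ ν : Measure X) : Measure X := (2⁻¹ : ℝ≥0) • (μ + ν)

lemma four_mul_energy_midMeasure {Y : Type*} [MeasurableSpace Y] {κ : Y → Y → ℝ≥0∞}
    (hκ : ∀ x y, κ x y = κ y x) (μ ν : Measure Y) [IsFiniteMeasure μ] [IsFiniteMeasure ν] :
    4 * energy κ (midMeasure μ ν) = energy κ μ + energy κ ν + 2 * mutualEnergy κ μ ν := by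
  have h : (midMeasure μ ν).prod (midMeasure μ ν) =
      (4⁻¹ : ℝ≥0) • ((μ.prod μ + ν.prod ν) + (μ.prod ν + ν.prod μ)) := by
    rw [midMeasure, Measure.prod_smul_left, Measure.prod_smul_right, smul_smul,
      Measure.prod_add, Measure.add_prod, Measure.add_prod]
    congr 1
    · norm_num
    · abel
  have h4 : (4 : ℝ≥0∞) * ((4⁻¹ : ℝ≥0) : ℝ≥0∞) = 1 := by
    rw [ENNReal.coe_inv (by norm_num)]
    exact ENNReal.mul_inv_cancel (by norm_num) (by norm_num)
  rw [two_mul]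
  nth_rw 2 [mutualEnergy_comm hκ]
  simp only [energy, mutualEnergy]
  rw [h, lintegral_smul_measure, lintegral_add_measure, lintegral_add_measure,
    lintegral_add_measure, ENNReal.smul_def, smul_eq_mul, ← mul_assoc, h4, one_mul]

lemma fieldIntegral_midMeasure {Y : Type*} [MeasurableSpace Y] {f : Y → EReal} {μ ν : Measure Y}
    (hμ : FieldIntegrable f μ)
    (hν : FieldIntegrable f ν) :
    fieldIntegral f (midMeasure μ ν) = (fieldIntegral f μ + fieldIntegral f ν) / 2 := by
  rw [fieldIntegral, midMeasure, integral_smul_nnreal_measure, integral_add_measure hμ.1 hν.1]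
  simp only [fieldIntegral, NNReal.smul_def, smul_eq_mul]
  push_cast
  ring

lemma Admissible.midMeasure [T2Space X] [LocallyCompactSpace X] [BorelSpace X]
    {κ : X → X → ℝ≥0∞} (hκ : ∀ x y, κ x y = κ y x) (hE : EnergyPrinciple κ) {A : Set X}
    {f : X → EReal} {μ ν : Measure X} (hμ : Admissible κ A f μ) (hν : Admissible κ A f ν) :
    Admissible κ A f (midMeasure μ ν) := by
  have : μ.Regular := hμ.1.1.1
  have : ν.Regular := hν.1.1.1
  have : IsFiniteMeasure μ := ⟨by simp [hμ.1.2.2]⟩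
  have : IsFiniteMeasure ν := ⟨by simp [hν.1.2.2]⟩
  refine ⟨⟨⟨?_, ?_⟩, ?_, ?_⟩, ?_, ?_⟩
  · exact Measure.Regular.smul_nnreal 2⁻¹
  · have h := four_mul_energy_midMeasure hκ μ ν
    have hlt : 4 * energy κ (GaussVar.midMeasure μ ν) < ⊤ := by
      rw [h]
      have := (hE μ ν hμ.1.1 hν.1.1).1
      have hsum := ENNReal.add_lt_top.2 ⟨hμ.1.1.2, hν.1.1.2⟩
      exact ENNReal.add_lt_top.2 ⟨hsum, this.trans_lt hsum⟩
    refine lt_of_le_of_lt ?_ hlt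
    exact le_mul_of_one_le_left zero_le (by norm_num)
  · intro K hK
    simp [GaussVar.midMeasure, hμ.1.2.1 K hK, hν.1.2.1 K hK]
  · simp only [GaussVar.midMeasure, Measure.smul_apply, Measure.add_apply, hμ.1.2.2, hν.1.2.2,
      ENNReal.smul_def, smul_eq_mul, ENNReal.coe_inv (two_ne_zero), one_add_one_eq_two]
    exact ENNReal.inv_mul_cancel (by simp) (by simp)
  · exact (hμ.2.1.add_measure hν.2.1).smul_measure_nnreal
  · exact Measure.ae_smul_measure (ae_add_measure_iff.2 ⟨hμ.2.2, hν.2.2⟩) _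

lemma strongDist_le_sqrt [T2Space X] [LocallyCompactSpace X] [BorelSpace X]
    {κ : X → X → ℝ≥0∞} (hκ : ∀ x y, κ x y = κ y x) (hE : EnergyPrinciple κ) {A : Set X}
    {f : X → EReal} {w : ℝ} (hw : ∀ μ, Admissible κ A f μ → w ≤ gaussI κ f μ) {μ ν : Measure X}
    (hμ : Admissible κ A f μ) (hν : Admissible κ A f ν) :
    strongDist κ μ ν ≤ √(2 * (gaussI κ f μ - w) + 2 * (gaussI κ f ν - w)) := by
  have : IsFiniteMeasure μ := ⟨by simp [hμ.1.2.2]⟩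
  have : IsFiniteMeasure ν := ⟨by simp [hν.1.2.2]⟩
  have hmid := hw _ (hμ.midMeasure hκ hE hν)
  have hIμ := hμ.1.1.2.ne
  have hIν := hν.1.1.2.ne
  have hI : 2 * mutualEnergy κ μ ν ≠ ⊤ :=
    ne_top_of_le_ne_top (ENNReal.add_ne_top.2 ⟨hIμ, hIν⟩) (hE μ ν hμ.1.1 hν.1.1).1
  have hen := congrArg ENNReal.toReal (four_mul_energy_midMeasure hκ μ ν)
  rw [ENNReal.toReal_add (ENNReal.add_ne_top.2 ⟨hIμ, hIν⟩) hI, ENNReal.toReal_add hIμ hIν,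
    ENNReal.toReal_mul, ENNReal.toReal_mul] at hen
  simp only [ENNReal.toReal_ofNat] at hen
  rw [gaussI, fieldIntegral_midMeasure hμ.2 hν.2] at hmid
  refine Real.sqrt_le_sqrt ?_
  simp only [gaussI]
  linarith

lemma strongCauchySeq_of_tendsto_gaussI [T2Space X] [LocallyCompactSpace X] [BorelSpace X]
    {κ : X → X → ℝ≥0∞} (hκ : ∀ x y, κ x y = κ y x) (hE : EnergyPrinciple κ) {A : Set X}
    {f : X → EReal} {w : ℝ} (hw : ∀ μ, Admissible κ A f μ → w ≤ gaussI κ f μ)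
    {μ : ℕ → Measure X} (hμ : ∀ j, Admissible κ A f (μ j))
    (hlim : Tendsto (fun j => gaussI κ f (μ j)) atTop (𝓝 w)) : StrongCauchySeq κ μ := by
  intro ε hε
  have hev : ∀ᶠ j in atTop, gaussI κ f (μ j) < w + ε ^ 2 / 4 :=
    hlim.eventually_lt_const (by linarith [pow_pos hε 2])
  obtain ⟨N, hN⟩ := eventually_atTop.1 hev
  refine ⟨N, fun m hm n hn => (strongDist_le_sqrt hκ hE hw (hμ m) (hμ n)).trans_lt ?_⟩
  rw [Real.sqrt_lt' hε]
  linarith [hN m hm, hN n hn]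

lemma VagueTendstoSeq.unique [T2Space X] [LocallyCompactSpace X] [BorelSpace X]
    {μ : ℕ → Measure X} {ξ η : Measure X} (hξ : IsRadon ξ) (hη : IsRadon η)
    (h₁ : VagueTendstoSeq μ ξ) (h₂ : VagueTendstoSeq μ η) : ξ = η := by
  have : ξ.Regular := hξ
  have : η.Regular := hη
  exact Measure.ext_of_integral_eq_on_compactlySupported fun φ =>
    tendsto_nhds_unique (h₁ φ φ.continuous φ.hasCompactSupport)
      (h₂ φ φ.continuous φ.hasCompactSupport)

/-- The sequence `μ 0, ν 0, μ 1, ν 1, …`. -/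
def interlace {α : Type*} (μ ν : ℕ → α) (n : ℕ) : α := if Even n then μ (n / 2) else ν (n / 2)

lemma interlace_two_mul {α : Type*} (μ ν : ℕ → α) (n : ℕ) : interlace μ ν (2 * n) = μ n := by
  simp [interlace]

lemma interlace_two_mul_add_one {α : Type*} (μ ν : ℕ → α) (n : ℕ) :
    interlace μ ν (2 * n + 1) = ν n := by
  have : (2 * n + 1) / 2 = n := by omega
  simp [interlace, this]

lemma tendsto_interlace {α : Type*} {l : Filter α} {μ ν : ℕ → α} (hμ : Tendsto μ atTop l)
    (hν : Tendsto ν atTop l) : Tendsto (interlace μ ν) atTop l := by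
  have h2 : Tendsto (fun n : ℕ => n / 2) atTop atTop := Nat.tendsto_div_const_atTop two_ne_zero
  exact (hμ.comp h2).if' (hν.comp h2)

theorem stmt16 {X : Type*} [TopologicalSpace X] [T2Space X] [LocallyCompactSpace X]
    [MeasurableSpace X] [BorelSpace X]
    (κ : X → X → ℝ≥0∞) (f : X → EReal) (A : Set X)
    (hker : IsKernel κ) (hperf : IsPerfect κ) (hf : IsExternalField κ f)
    (hw : wf κ A f < ⊤) :
    ∃! ξ : Measure X, memEplus κ ξ ∧
      ∀ μ : ℕ → Measure X, (∀ j, Admissible κ A f (μ j)) →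
        Tendsto (fun j => ((gaussI κ f (μ j) : ℝ) : EReal)) atTop (𝓝 (wf κ A f)) →
        StrongTendstoSeq κ μ ξ ∧ VagueTendstoSeq μ ξ := by
  obtain ⟨hE, hcomplete, hvague⟩ := hperf
  obtain ⟨m, hm⟩ := hf.exists_le_gaussI hE hker.2 A
  have hbot : wf κ A f ≠ ⊥ := by
    have : (m : EReal) ≤ wf κ A f := le_iInf₂ fun μ hμ => by exact_mod_cast hm μ hμ
    exact fun h => absurd (le_bot_iff.1 (h ▸ this)) (EReal.coe_ne_bot m)
  obtain ⟨w, hw'⟩ : ∃ w : ℝ, (w : EReal) = wf κ A f := ⟨_, EReal.coe_toReal hw.ne hbot⟩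
  have hwle : ∀ μ, Admissible κ A f μ → w ≤ gaussI κ f μ := fun μ hμ => by
    have : wf κ A f ≤ ((gaussI κ f μ : ℝ) : EReal) := iInf₂_le μ hμ
    rw [← hw'] at this
    exact_mod_cast this
  simp only [← hw', EReal.tendsto_coe]
  have hexist : ∀ μ : ℕ → Measure X, (∀ j, Admissible κ A f (μ j)) →
      Tendsto (fun j => gaussI κ f (μ j)) atTop (𝓝 w) →
      ∃ ξ, memEplus κ ξ ∧ StrongTendstoSeq κ μ ξ ∧ VagueTendstoSeq μ ξ := by
    intro μ hμ hlim
    obtain ⟨ξ, hξ, hs⟩ := hcomplete μ (fun n => (hμ n).1.1)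
      (strongCauchySeq_of_tendsto_gaussI hker.1 hE hwle hμ hlim)
    exact ⟨ξ, hξ, hs, hvague μ ξ (fun n => (hμ n).1.1) hξ hs⟩
  obtain ⟨ν, hν, hνlim⟩ : ∃ ν : ℕ → Measure X, (∀ j, Admissible κ A f (ν j)) ∧
      Tendsto (fun j => gaussI κ f (ν j)) atTop (𝓝 w) := by
    have hlt : ∀ n : ℕ, ∃ μ, Admissible κ A f μ ∧ gaussI κ f μ < w + 1 / ((n : ℝ) + 1) := by
      intro n
      have : wf κ A f < ((w + 1 / ((n : ℝ) + 1) : ℝ) : EReal) := by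
        rw [← hw']
        exact_mod_cast lt_add_of_pos_right w Nat.one_div_pos_of_nat
      obtain ⟨μ, hμ⟩ := iInf_lt_iff.1 this
      obtain ⟨hadm, hμ⟩ := iInf_lt_iff.1 hμ
      exact ⟨μ, hadm, by exact_mod_cast hμ⟩
    choose ν hν hνlt using hlt
    refine ⟨ν, hν, tendsto_of_tendsto_of_tendsto_of_le_of_le tendsto_const_nhds ?_
      (fun n => hwle _ (hν n)) fun n => (hνlt n).le⟩
    simpa using tendsto_one_div_add_atTop_nhds_zero_nat.const_add w
  obtain ⟨ξ, hξ, -, hξv⟩ := hexist ν hν hνlim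
  refine ⟨ξ, ⟨hξ, fun μ hμ hlim => ?_⟩, fun η hη => ?_⟩
  · have hadm : ∀ j, Admissible κ A f (interlace μ ν j) := fun j => by
      unfold interlace
      split_ifs
      exacts [hμ _, hν _]
    have hval : (fun j => gaussI κ f (interlace μ ν j)) =
        interlace (fun j => gaussI κ f (μ j)) fun j => gaussI κ f (ν j) := by
      funext j
      simp only [interlace]
      split_ifs <;> rfl
    obtain ⟨η, hη, hηs, hηv⟩ := hexist _ hadm (hval ▸ tendsto_interlace hlim hνlim)
    have heven : Tendsto (fun n : ℕ => 2 * n) atTop atTop :=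
      tendsto_id.const_mul_atTop' two_pos
    have hodd : Tendsto (fun n : ℕ => 2 * n + 1) atTop atTop :=
      (tendsto_add_atTop_nat 1).comp heven
    have hηξ : η = ξ := by
      refine VagueTendstoSeq.unique hη.1 hξ.1 (fun φ hφ hφc => ?_) hξv
      simpa only [Function.comp_def, interlace_two_mul_add_one] using (hηv φ hφ hφc).comp hodd
    subst hηξ
    have hs : StrongTendstoSeq κ μ η := by
      have h := Tendsto.comp hηs heven
      simp only [Function.comp_def, interlace_two_mul] at h
      exact h
    exact ⟨hs, hvague μ η (fun n => (hμ n).1.1) hη hs⟩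
  · exact VagueTendstoSeq.unique hη.1.1 hξ.1 (hη.2 ν hν hνlim).2 hξv

end GaussVar
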